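/- arXiv:1902.08569 — 10 statements merged into one kernel-verified Lean document; each statement's English description precedes it below -/
import Mathlib

section
/- Let μ be a non-degenerate product on ℂ³, i.e., a bilinear skew-symmetric map whose matrix M_μ has invertible symmetric part (M_μ + M_μᵗ)/2. Then, under the GL₃(ℂ)-action M ↦ (det g)⁻¹ · g · M · gᵗ, the matrix M_μ is equivalent to exactly one of the following: M_{1;a} = [[1,0,0],[0,1,−a],[0,a,1]] for some a ∈ ℂ ∖ {0}, M₂ = 1₃ (the 3×3 identity matrix), or M₃ = [[0,1,0],[1,0,−1],[0,1,1]]. Matrices of different types are never equivalent, and M_{1;a} is equivalent to M_{1;a′} if and only if a = ±a′. -/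
noncomputable section
open Matrix

abbrev V3 : Type := Fin 3 → ℂ
abbrev Mat3 : Type := Matrix (Fin 3) (Fin 3) ℂ

/-- The cross product on `ℂ³`. -/
def cross3 (x y : V3) : V3 :=
  ![x 1 * y 2 - x 2 * y 1, x 2 * y 0 - x 0 * y 2, x 0 * y 1 - x 1 * y 0]

/-- The skew-symmetric bilinear product on `ℂ³` encoded by the matrix `M`:
`μ(e₂,e₃) = col₀ M`, `μ(e₃,e₁) = col₁ M`, `μ(e₁,e₂) = col₂ M`. -/
def prodOf (M : Mat3) : V3 → V3 → V3 := fun x y => M.mulVec (cross3 x y)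

/-- `T` satisfies the Hom-Lie Jacobi identity for the product `μ`. -/
def HL (μ : V3 → V3 → V3) (T : Mat3) : Prop :=
  ∀ x y z : V3,
    μ (T.mulVec x) (μ y z) + μ (T.mulVec y) (μ z x) + μ (T.mulVec z) (μ x y) = 0

/-- `g` is an invertible automorphism of the product `μ`. -/
def IsAut (μ : V3 → V3 → V3) (g : Mat3) : Prop :=
  g.det ≠ 0 ∧ ∀ x y : V3, g.mulVec (μ x y) = μ (g.mulVec x) (g.mulVec y)

/-- Equivalence of elements of `HL(μ)` under the action `T ↦ g ∘ T ∘ g⁻¹` of `G_μ`. -/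
def HLequiv (μ : V3 → V3 → V3) (T T' : Mat3) : Prop :=
  ∃ g : Mat3, IsAut μ g ∧ T' = g * T * g⁻¹

/-- Equivalence of matrices under the `GL₃(ℂ)`-action `M ↦ (det g)⁻¹ • g * M * gᵀ`. -/
def MEquiv (A B : Mat3) : Prop :=
  ∃ g : Mat3, g.det ≠ 0 ∧ B = (g.det)⁻¹ • (g * A * gᵀ)

/-- Equivalence of products under the `GL₃(ℂ)`-action `(g·μ)(x,y) = g(μ(g⁻¹x, g⁻¹y))`. -/
def ProdEquiv (μ ν : V3 → V3 → V3) : Prop :=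
  ∃ g : Mat3, g.det ≠ 0 ∧ ∀ x y : V3, ν x y = g.mulVec (μ (g⁻¹.mulVec x) (g⁻¹.mulVec y))

/-- `M_{1;a}` -/
def Mone (a : ℂ) : Mat3 := !![1, 0, 0; 0, 1, -a; 0, a, 1]

/-- `M₃` -/
def Mthree : Mat3 := !![0, 1, 0; 1, 0, -1; 0, 1, 1]

theorem MEquiv.trans {A B C : Mat3} (hAB : MEquiv A B) (hBC : MEquiv B C) : MEquiv A C := by
  obtain ⟨g, hg, rfl⟩ := hAB
  obtain ⟨h, hh, rfl⟩ := hBC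
  refine ⟨h * g, by simp [hg, hh], ?_⟩
  simp only [det_mul, mul_inv, transpose_mul, Matrix.mul_smul, Matrix.smul_mul, smul_smul,
    Matrix.mul_assoc]

theorem MEquiv.isSymm_left {A B : Mat3} (h : MEquiv A B) (hB : B.IsSymm) : A.IsSymm := by
  obtain ⟨g, hg, rfl⟩ := h
  have hu : IsUnit g := (isUnit_iff_isUnit_det g).2 hg.isUnit
  have hs : g * Aᵀ * gᵀ = g * A * gᵀ := by
    have hs := smul_right_injective Mat3 (inv_ne_zero hg) (by simpa [IsSymm] using hB)
    simpa [Matrix.mul_assoc] using hs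
  exact hu.mul_left_cancel (((isUnit_transpose g).2 hu).mul_right_cancel hs)

/-- The ratio of `det M` to the determinant of the symmetric part of `M` is an invariant. -/
theorem MEquiv.det_mul_det_symm {A B : Mat3} (h : MEquiv A B) :
    A.det * (B + Bᵀ).det = B.det * (A + Aᵀ).det := by
  obtain ⟨g, hg, rfl⟩ := h
  have hs : (g.det)⁻¹ • (g * A * gᵀ) + ((g.det)⁻¹ • (g * A * gᵀ))ᵀ
      = (g.det)⁻¹ • (g * (A + Aᵀ) * gᵀ) := by
    simp [Matrix.mul_add, Matrix.add_mul, Matrix.mul_assoc]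
  rw [hs]
  simp only [det_smul, det_mul, det_transpose]
  ring

/-- A nondegenerate symmetric complex matrix is congruent to the identity. -/
theorem Matrix.IsSymm.exists_mul_mul_transpose_eq_one {n : ℕ} {S : Matrix (Fin n) (Fin n) ℂ}
    (hS : S.IsSymm) (hdet : S.det ≠ 0) :
    ∃ g : Matrix (Fin n) (Fin n) ℂ, g * S * gᵀ = 1 := by
  obtain ⟨v, hv⟩ := LinearMap.BilinForm.exists_orthogonal_basis
    (LinearMap.BilinForm.isSymm_iff.1 (isSymm_toBilin'_iff_isSymm.2 hS))
  have hne := hv.not_isOrtho_basis_self_of_separatingLeft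
    (LinearMap.BilinForm.nondegenerate_toBilin'_of_det_ne_zero' S hdet).1
  let e := finCongr (Module.finrank_fin_fun ℂ (n := n))
  choose c hc using fun i ↦ IsAlgClosed.exists_pow_nat_eq
    (S.toBilin' (v (e.symm i)) (v (e.symm i)))⁻¹ two_pos
  refine ⟨of fun i ↦ c i • v (e.symm i), ?_⟩
  ext i j
  have hentry : ((of fun i ↦ c i • v (e.symm i)) * S * (of fun i ↦ c i • v (e.symm i))ᵀ) i j
      = c i * c j * S.toBilin' (v (e.symm i)) (v (e.symm j)) := by
    trans S.toBilin' (c i • v (e.symm i)) (c j • v (e.symm j))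
    · rw [toBilin'_apply', dotProduct_mulVec]
      rfl
    · simp [mul_assoc, mul_left_comm]
  rw [hentry]
  rcases eq_or_ne i j with rfl | hij
  · rw [one_apply_eq, ← sq, hc]
    exact inv_mul_cancel₀ (hne _)
  · rw [one_apply_ne hij, show S.toBilin' (v (e.symm i)) (v (e.symm j)) = 0 from
      hv (e.symm.injective.ne hij), mul_zero]

/-- The matrix `1 + [v]ₓ`, where `v = (x, y, z)`. -/
def oneAddCross (x y z : ℂ) : Mat3 := !![1, -z, y; z, 1, -x; -y, x, 1]

theorem exists_mEquiv_oneAddCross {M : Mat3} (hM : (((1 : ℂ) / 2) • (M + Mᵀ)).det ≠ 0) :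
    ∃ x y z : ℂ, MEquiv M (oneAddCross x y z) := by
  have hsymm : (((1 : ℂ) / 2) • (M + Mᵀ)).IsSymm := by simp [IsSymm, add_comm]
  obtain ⟨g, hg⟩ := hsymm.exists_mul_mul_transpose_eq_one hM
  have hd : g.det ≠ 0 := fun h ↦ by simpa [h] using congrArg det hg
  set h : Mat3 := (g.det)⁻¹ • g with hh
  have hdet : h.det = (g.det)⁻¹ ^ 2 := by
    simp only [hh, det_smul, Fintype.card_fin]
    field_simp
  set N : Mat3 := (h.det)⁻¹ • (h * M * hᵀ) with hN
  have hNg : N = g * M * gᵀ := by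
    rw [hN, hdet, hh]
    simp only [transpose_smul, Matrix.smul_mul, Matrix.mul_smul, smul_smul]
    rw [show ((g.det)⁻¹ ^ 2)⁻¹ * ((g.det)⁻¹ * (g.det)⁻¹) = 1 by field_simp, one_smul]
  have hsum : N + Nᵀ = (2 : ℂ) • (1 : Mat3) := by
    rw [← hg, hNg]
    simp [Matrix.mul_add, Matrix.add_mul, Matrix.mul_assoc, smul_smul]
  have hent (i j : Fin 3) : N i j + N j i = 2 * (1 : Mat3) i j := by
    simpa using congrFun (congrFun hsum i) j
  refine ⟨N 2 1, N 0 2, N 1 0, h, by rw [hdet]; positivity, ?_⟩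
  rw [← hN]
  have h00 := hent 0 0
  have h11 := hent 1 1
  have h22 := hent 2 2
  have h01 := hent 0 1
  have h02 := hent 0 2
  have h12 := hent 1 2
  simp at h00 h11 h22 h01 h02 h12
  ext i j
  fin_cases i <;> fin_cases j <;> simp [oneAddCross] <;> grind

theorem exists_unit_orthogonal {x y z : ℂ} (h : x ^ 2 + y ^ 2 + z ^ 2 ≠ 0) :
    ∃ p q r : ℂ, p ^ 2 + q ^ 2 + r ^ 2 = 1 ∧ p * x + q * y + r * z = 0 := by
  have key : ∃ p q r : ℂ, p ^ 2 + q ^ 2 + r ^ 2 ≠ 0 ∧ p * x + q * y + r * z = 0 := by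
    by_contra! hc
    have h₁ : y ^ 2 + x ^ 2 = 0 := by
      by_contra hn
      exact hc (-y) x 0 (by simpa using hn) (by ring)
    have h₂ : z ^ 2 + x ^ 2 = 0 := by
      by_contra hn
      exact hc (-z) 0 x (by simpa using hn) (by ring)
    have h₃ : z ^ 2 + y ^ 2 = 0 := by
      by_contra hn
      exact hc 0 (-z) y (by simpa using hn) (by ring)
    exact h (by linear_combination (h₁ + h₂ + h₃) / 2)
  obtain ⟨p, q, r, hn, ho⟩ := key
  obtain ⟨s, hs⟩ := IsAlgClosed.exists_pow_nat_eq (p ^ 2 + q ^ 2 + r ^ 2)⁻¹ two_pos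
  refine ⟨s * p, s * q, s * r, ?_, by linear_combination s * ho⟩
  rw [show (s * p) ^ 2 + (s * q) ^ 2 + (s * r) ^ 2 = s ^ 2 * (p ^ 2 + q ^ 2 + r ^ 2) by ring, hs]
  exact inv_mul_cancel₀ hn

theorem oneAddCross_mEquiv_Mone {x y z a : ℂ} (ha : a ≠ 0)
    (h : x ^ 2 + y ^ 2 + z ^ 2 = a ^ 2) : MEquiv (oneAddCross x y z) (Mone a) := by
  obtain ⟨p, q, r, hn, ho⟩ := exists_unit_orthogonal (h ▸ pow_ne_zero 2 ha)
  obtain ⟨l, m, n, rfl, rfl, rfl⟩ : ∃ l m n, x = a * l ∧ y = a * m ∧ z = a * n :=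
    ⟨x / a, y / a, z / a, by field_simp, by field_simp, by field_simp⟩
  have hl : l ^ 2 + m ^ 2 + n ^ 2 = 1 :=
    mul_left_cancel₀ (pow_ne_zero 2 ha) (by linear_combination h)
  have ho' : p * l + q * m + r * n = 0 := mul_left_cancel₀ ha (by linear_combination ho)
  set g : Mat3 := !![l, m, n; p, q, r; m * r - n * q, n * p - l * r, l * q - m * p] with hg
  have hdet : g.det = 1 := by
    simp [hg, det_fin_three]
    linear_combination (p ^ 2 + q ^ 2 + r ^ 2) * hl + hn - (p * l + q * m + r * n) * ho'
  refine ⟨g, by simp [hdet], ?_⟩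
  rw [hdet, inv_one, one_smul]
  ext i j
  fin_cases i <;> fin_cases j <;>
    simp [hg, Mone, oneAddCross, vecMul, dotProduct, Fin.sum_univ_three] <;> grind

theorem oneAddCross_mEquiv_Mthree {x y z : ℂ} (hne : ¬ (x = 0 ∧ y = 0 ∧ z = 0))
    (h : x ^ 2 + y ^ 2 + z ^ 2 = 0) : MEquiv (oneAddCross x y z) Mthree := by
  obtain ⟨p, q, r, hn, ho⟩ : ∃ p q r : ℂ,
      p ^ 2 + q ^ 2 + r ^ 2 = 0 ∧ p * x + q * y + r * z = 1 := by
    by_cases hx : x = 0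
    · by_cases hy : y = 0
      · have hz : z ≠ 0 := fun hz ↦ hne ⟨hx, hy, hz⟩
        refine ⟨-x / (2 * z ^ 2), -y / (2 * z ^ 2), 1 / (2 * z), ?_, ?_⟩
        · field_simp
          linear_combination h
        · field_simp
          linear_combination -h
      · refine ⟨-x / (2 * y ^ 2), 1 / (2 * y), -z / (2 * y ^ 2), ?_, ?_⟩
        · field_simp
          linear_combination h
        · field_simp
          linear_combination -h
    · refine ⟨1 / (2 * x), -y / (2 * x ^ 2), -z / (2 * x ^ 2), ?_, ?_⟩
      · field_simp
        linear_combination h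
      · field_simp
        linear_combination -h
  set g : Mat3 := !![x, y, z; -p, -q, -r; q * z - r * y, r * x - p * z, p * y - q * x] with hg
  have hdet : g.det = -1 := by
    simp [hg, det_fin_three]
    linear_combination (p ^ 2 + q ^ 2 + r ^ 2) * h - (p * x + q * y + r * z + 1) * ho
  refine ⟨g, by simp [hdet], ?_⟩
  rw [hdet]
  ext i j
  fin_cases i <;> fin_cases j <;>
    simp [hg, Mthree, oneAddCross, vecMul, dotProduct, Fin.sum_univ_three] <;> grind

theorem det_Mone (a : ℂ) : (Mone a).det = 1 + a ^ 2 := by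
  simp [Mone, det_fin_three]
  ring

theorem det_Mone_add_transpose (a : ℂ) : (Mone a + (Mone a)ᵀ).det = 8 := by
  simp [Mone, det_fin_three]
  norm_num

theorem det_Mthree : Mthree.det = -1 := by
  simp [Mthree, det_fin_three]

theorem det_Mthree_add_transpose : (Mthree + Mthreeᵀ).det = -8 := by
  simp [Mthree, det_fin_three]
  norm_num

theorem Mone_mEquiv_neg (a : ℂ) : MEquiv (Mone a) (Mone (-a)) := by
  have hdet : (!![-1, 0, 0; 0, -1, 0; 0, 0, 1] : Mat3).det = 1 := by simp [det_fin_three]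
  refine ⟨!![-1, 0, 0; 0, -1, 0; 0, 0, 1], by simp [hdet], ?_⟩
  rw [hdet]
  ext i j
  fin_cases i <;> fin_cases j <;> simp [Mone, vecMul, dotProduct, Fin.sum_univ_three]

theorem MEquiv.refl (A : Mat3) : MEquiv A A := ⟨1, by simp, by simp⟩

theorem stmt0 (M : Mat3) (hM : (((1 : ℂ) / 2) • (M + Mᵀ)).det ≠ 0) :
    ((∃ a : ℂ, a ≠ 0 ∧ MEquiv M (Mone a)) ∨ MEquiv M (1 : Mat3) ∨ MEquiv M Mthree) ∧
    (∀ a : ℂ, a ≠ 0 → ¬ MEquiv (Mone a) (1 : Mat3)) ∧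
    (∀ a : ℂ, a ≠ 0 → ¬ MEquiv (Mone a) Mthree) ∧
    ¬ MEquiv (1 : Mat3) Mthree ∧
    (∀ a a' : ℂ, a ≠ 0 → a' ≠ 0 → (MEquiv (Mone a) (Mone a') ↔ (a = a' ∨ a = -a'))) := by
  refine ⟨?_, fun a ha h ↦ ?_, fun a ha h ↦ ?_, fun h ↦ ?_, fun a a' ha ha' ↦ ⟨fun h ↦ ?_, ?_⟩⟩
  · obtain ⟨x, y, z, h⟩ := exists_mEquiv_oneAddCross hM
    by_cases hxyz : x = 0 ∧ y = 0 ∧ z = 0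
    · obtain ⟨rfl, rfl, rfl⟩ := hxyz
      refine .inr (.inl ?_)
      convert h
      ext i j
      fin_cases i <;> fin_cases j <;> simp [oneAddCross]
    obtain ⟨a, ha⟩ := IsAlgClosed.exists_pow_nat_eq (x ^ 2 + y ^ 2 + z ^ 2) two_pos
    rcases eq_or_ne a 0 with rfl | ha0
    · exact .inr (.inr (h.trans (oneAddCross_mEquiv_Mthree hxyz (by simpa using ha.symm))))
    · exact .inl ⟨a, ha0, h.trans (oneAddCross_mEquiv_Mone ha0 ha.symm)⟩
  · have hs := congrFun (congrFun (h.isSymm_left isSymm_one) 1) 2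
    simp [Mone] at hs
    grind
  · have hd := h.det_mul_det_symm
    rw [det_Mone, det_Mone_add_transpose, det_Mthree, det_Mthree_add_transpose] at hd
    exact ha (pow_eq_zero_iff two_ne_zero |>.1 (by linear_combination -hd / 8))
  · obtain ⟨g, hg, hgB⟩ := h
    have hs : Mthree.IsSymm := by simp [IsSymm, hgB]
    have := congrFun (congrFun hs 1) 2
    simp [Mthree] at this
    grind
  · have hd := h.det_mul_det_symm
    rw [det_Mone, det_Mone_add_transpose, det_Mone, det_Mone_add_transpose] at hd
    exact sq_eq_sq_iff_eq_or_eq_neg.1 (by linear_combination hd / 8)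
  · rintro (rfl | rfl)
    · exact .refl _
    · simpa using Mone_mEquiv_neg (-a')
end
end

section
/- Let I₂ = diag(1,1,0) and I₁ = diag(1,0,0) in Mat₃(ℂ), and for ℓ ∈ {1,2} let G_ℓ = {g ∈ GL₃(ℂ) : (det g)⁻¹ · g · I_ℓ · gᵗ = I_ℓ}. Then: (1) G₂ consists exactly of the block matrices [[B, v],[0, ε]] with B ∈ GL₂(ℂ), v ∈ ℂ², ε = ±1, and B·Bᵗ = ε·(det B)·1₂; (2) G₁ consists exactly of the block matrices [[a, vᵗ],[0, B]] with B ∈ GL₂(ℂ), v ∈ ℂ², and a = det B ≠ 0. -/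
noncomputable section
open Matrix

/-- `I₂ = diag(1,1,0)` -/
def Itwo : Mat3 := Matrix.diagonal ![1, 1, 0]

/-- `I₁ = diag(1,0,0)` -/
def Ione : Mat3 := Matrix.diagonal ![1, 0, 0]

/-- The upper-left `2×2` block of a `3×3` matrix. -/
def ulBlock (g : Mat3) : Matrix (Fin 2) (Fin 2) ℂ :=
  Matrix.of fun i j => g i.castSucc j.castSucc

/-- The lower-right `2×2` block of a `3×3` matrix. -/
def lrBlock (g : Mat3) : Matrix (Fin 2) (Fin 2) ℂ :=
  Matrix.of fun i j => g i.succ j.succ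

theorem ulBlock_det (g : Mat3) :
    (ulBlock g).det = g 0 0 * g 1 1 - g 0 1 * g 1 0 := by
  simp [Matrix.det_fin_two, ulBlock]

theorem lrBlock_det (g : Mat3) :
    (lrBlock g).det = g 1 1 * g 2 2 - g 1 2 * g 2 1 := by
  simp [Matrix.det_fin_two, lrBlock]

theorem ulBlock_mul_transpose_eq_smul_one_iff (g : Mat3) (c : ℂ) :
    ulBlock g * (ulBlock g)ᵀ = c • (1 : Matrix (Fin 2) (Fin 2) ℂ) ↔
      g 0 0 * g 0 0 + g 0 1 * g 0 1 = c ∧ g 0 0 * g 1 0 + g 0 1 * g 1 1 = 0 ∧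
        g 1 0 * g 1 0 + g 1 1 * g 1 1 = c := by
  simp only [← Matrix.ext_iff, Fin.forall_fin_two]
  simp [Matrix.mul_apply, Fin.sum_univ_two, ulBlock]
  grind

theorem mul_Itwo_mul_transpose_eq_iff (g : Mat3) (c : ℂ) :
    g * Itwo * gᵀ = c • Itwo ↔
      (g 0 0 * g 0 0 + g 0 1 * g 0 1 = c ∧ g 0 0 * g 1 0 + g 0 1 * g 1 1 = 0 ∧
        g 1 0 * g 1 0 + g 1 1 * g 1 1 = c) ∧
      g 0 0 * g 2 0 + g 0 1 * g 2 1 = 0 ∧ g 1 0 * g 2 0 + g 1 1 * g 2 1 = 0 ∧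
        g 2 0 * g 2 0 + g 2 1 * g 2 1 = 0 := by
  simp only [← Matrix.ext_iff, Fin.forall_fin_succ, Itwo]
  simp [Matrix.mul_apply, Fin.sum_univ_three, Matrix.diagonal_apply]
  grind

theorem mul_Ione_mul_transpose_eq_iff (g : Mat3) (c : ℂ) :
    g * Ione * gᵀ = c • Ione ↔
      g 0 0 * g 0 0 = c ∧ g 0 0 * g 1 0 = 0 ∧ g 0 0 * g 2 0 = 0 ∧
        g 1 0 * g 1 0 = 0 ∧ g 1 0 * g 2 0 = 0 ∧ g 2 0 * g 2 0 = 0 := by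
  simp only [← Matrix.ext_iff, Fin.forall_fin_succ, Ione]
  simp [Matrix.mul_apply, Fin.sum_univ_three, Matrix.diagonal_apply]
  grind

theorem stmt1 (g : Mat3) (hg : g.det ≠ 0) :
    ((g.det)⁻¹ • (g * Itwo * gᵀ) = Itwo ↔
      (g 2 0 = 0 ∧ g 2 1 = 0 ∧ (g 2 2 = 1 ∨ g 2 2 = -1) ∧
        (ulBlock g).det ≠ 0 ∧
        ulBlock g * (ulBlock g)ᵀ
          = (g 2 2 * (ulBlock g).det) • (1 : Matrix (Fin 2) (Fin 2) ℂ))) ∧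
    ((g.det)⁻¹ • (g * Ione * gᵀ) = Ione ↔
      (g 1 0 = 0 ∧ g 2 0 = 0 ∧ (lrBlock g).det = g 0 0 ∧ g 0 0 ≠ 0)) := by
  have hdet := Matrix.det_fin_three g
  rw [inv_smul_eq_iff₀ hg, inv_smul_eq_iff₀ hg, mul_Itwo_mul_transpose_eq_iff,
    mul_Ione_mul_transpose_eq_iff, ulBlock_mul_transpose_eq_smul_one_iff, ulBlock_det,
    lrBlock_det]
  generalize g.det = D at *
  generalize g 0 0 = a, g 0 1 = b, g 0 2 = c, g 1 0 = d, g 1 1 = e, g 1 2 = f,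
    g 2 0 = x, g 2 1 = y, g 2 2 = z at *
  constructor
  · constructor
    · rintro ⟨⟨h1, h2, h3⟩, h4, h5, -⟩
      have hsq : (a * e - b * d) ^ 2 = D ^ 2 := by
        linear_combination (d * d + e * e) * h1 + D * h3 - (a * d + b * e) * h2
      have hB : a * e - b * d ≠ 0 := by
        intro h
        rw [h] at hsq
        exact hg (by simpa using hsq.symm)
      have hx : x = 0 := by
        refine (mul_eq_zero.mp ?_).resolve_left hB
        linear_combination e * h4 - b * h5
      have hy : y = 0 := by
        refine (mul_eq_zero.mp ?_).resolve_left hB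
        linear_combination a * h5 - d * h4
      subst hx hy
      have hD : D = z * (a * e - b * d) := by linear_combination hdet
      refine ⟨rfl, rfl, ?_, hB, by rw [h1, hD], h2, by rw [h3, hD]⟩
      rw [← sq_eq_one_iff]
      refine mul_right_cancel₀ (pow_ne_zero 2 hB) ?_
      rw [hD] at hsq
      linear_combination -hsq
    · rintro ⟨rfl, rfl, -, -, h1, h2, h3⟩
      have hD : D = z * (a * e - b * d) := by linear_combination hdet
      simp [hD, h1, h2, h3]
  · constructor
    · rintro ⟨h1, h2, h3, -⟩
      have ha : a ≠ 0 := by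
        rintro rfl
        exact hg (by simpa using h1.symm)
      have hd : d = 0 := (mul_eq_zero.mp h2).resolve_left ha
      have hx : x = 0 := (mul_eq_zero.mp h3).resolve_left ha
      subst hd hx
      refine ⟨rfl, rfl, mul_left_cancel₀ ha ?_, ha⟩
      linear_combination -h1 - hdet
    · rintro ⟨rfl, rfl, h, -⟩
      refine ⟨?_, by simp⟩
      linear_combination -hdet - a * h
end
end

section
/- Let μ = I₁ + A and μ′ = I₁ + A′ be matrices in Mat₃(ℂ), where I₁ = diag(1,0,0) and A, A′ are the skew-symmetric matrices corresponding to nonzero vectors a = (x,y,z) and a′ = (x′,y′,z′) in ℂ³. Then μ and μ′ are equivalent under the GL₃(ℂ)-action M ↦ (det g)⁻¹ · g · M · gᵗ if and only if either both x ≠ 0 and x′ ≠ 0, or both x = 0 and x′ = 0. In particular, there are exactly two orbits of such matrices. -/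
noncomputable section
open Matrix

/-- The skew-symmetric matrix corresponding to the vector `a ∈ ℂ³`. -/
def skewOf (a : V3) : Mat3 :=
  !![0, -a 2, a 1; a 2, 0, -a 0; -a 1, a 0, 0]

/-- A block upper triangular `g` whose determinant is the square of its top left entry carries
`Ione + skewOf (gᵀ *ᵥ b)` to `Ione + skewOf b`. -/
lemma MEquiv.of_blockTriangular {a a' : V3} (p q r s t u : ℂ) (hc : r * u - s * t ≠ 0)
    (h0 : a 0 = (r * u - s * t) * a' 0) (h1 : a 1 = p * a' 0 + r * a' 1 + t * a' 2)
    (h2 : a 2 = q * a' 0 + s * a' 1 + u * a' 2) :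
    MEquiv (Ione + skewOf a) (Ione + skewOf a') := by
  have hdet : (!![r * u - s * t, p, q; 0, r, s; 0, t, u] : Mat3).det = (r * u - s * t) ^ 2 := by
    simp [det_fin_three]
    ring
  refine ⟨!![r * u - s * t, p, q; 0, r, s; 0, t, u], hdet ▸ pow_ne_zero 2 hc, ?_⟩
  rw [hdet, eq_inv_smul_iff₀ (pow_ne_zero 2 hc)]
  ext i j
  fin_cases i <;> fin_cases j <;>
    simp [Ione, skewOf, Matrix.mul_apply, vecMul, dotProduct, Fin.sum_univ_three, h0, h1, h2] <;>
    ring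

/-- Equivalent matrices `I₁ + skewOf a` have first coordinates differing by a nonzero scalar. -/
lemma MEquiv.exists_apply_zero_eq {a a' : V3} (h : MEquiv (Ione + skewOf a) (Ione + skewOf a')) :
    ∃ c : ℂ, c ≠ 0 ∧ a 0 = c * a' 0 := by
  obtain ⟨g, hg, h⟩ := h
  rw [eq_inv_smul_iff₀ hg] at h
  have entry := fun i j => congrFun (congrFun h i) j
  have e00 := entry 0 0
  have e11 := entry 1 1
  have e22 := entry 2 2
  have e21 := entry 2 1
  simp [Ione, skewOf, Matrix.mul_apply, Fin.sum_univ_three] at e00 e11 e22 e21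
  have g1 : g 1 0 = 0 := pow_eq_zero_iff two_ne_zero |>.1 (by linear_combination -e11)
  have g2 : g 2 0 = 0 := pow_eq_zero_iff two_ne_zero |>.1 (by linear_combination -e22)
  have hd : g.det = g 0 0 ^ 2 := by linear_combination e00
  have hc : g 0 0 ≠ 0 := fun h0 => hg (by simp [hd, h0])
  have hm : g 1 1 * g 2 2 - g 1 2 * g 2 1 = g 0 0 := by
    apply mul_left_cancel₀ hc
    rw [det_fin_three, g1, g2] at hd
    linear_combination hd
  refine ⟨g 0 0, hc, mul_left_cancel₀ hc ?_⟩
  rw [hd, g1, g2] at e21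
  linear_combination -e21 - a 0 * hm

theorem stmt3 (a a' : V3) (ha : a ≠ 0) (ha' : a' ≠ 0) :
    MEquiv (Ione + skewOf a) (Ione + skewOf a') ↔
      ((a 0 ≠ 0 ∧ a' 0 ≠ 0) ∨ (a 0 = 0 ∧ a' 0 = 0)) := by
  constructor
  · intro h
    obtain ⟨c, hc, h0⟩ := h.exists_apply_zero_eq
    by_cases hx : a' 0 = 0 <;> simp [h0, hc, hx]
  rintro (⟨hx, hx'⟩ | ⟨hx, hx'⟩)
  · apply MEquiv.of_blockTriangular ((a 1 - a 0 / a' 0 * a' 1) / a' 0) ((a 2 - a' 2) / a' 0)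
      (a 0 / a' 0) 0 0 1 <;> field_simp <;> simp [hx, hx']
  have hz : a 1 = 0 → a 2 ≠ 0 := fun h1 h2 => ha (by ext i; fin_cases i <;> simp [hx, h1, h2])
  have hz' : a' 1 = 0 → a' 2 ≠ 0 := fun h1 h2 =>
    ha' (by ext i; fin_cases i <;> simp [hx', h1, h2])
  by_cases hy : a 1 = 0 <;> by_cases hy' : a' 1 = 0
  · have := hz hy
    have := hz' hy'
    apply MEquiv.of_blockTriangular 0 0 1 0 0 (a 2 / a' 2) <;> simp_all
  · have := hz hy
    apply MEquiv.of_blockTriangular 0 0 (-a' 2) (a 2 / a' 1) (a' 1) 0 <;> simp_all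
    ring
  · have := hz' hy'
    apply MEquiv.of_blockTriangular 0 0 0 1 (a 1 / a' 2) (a 2 / a' 2) <;> simp_all
  · apply MEquiv.of_blockTriangular 0 0 (a 1 / a' 1) ((a 2 - a' 2) / a' 1) 0 1 <;> simp_all
end
end

section
/- Let a ∈ ℂ with a ≠ 0 and a ≠ ±i, and let μ_{1;a} be the product on ℂ³ given by μ_{1;a}(e₁,e₂) = −a·e₂ + e₃, μ_{1;a}(e₂,e₃) = e₁, μ_{1;a}(e₃,e₁) = e₂ + a·e₃. Then a linear map T : ℂ³ → ℂ³ with matrix (T_{ij}) belongs to HL(μ_{1;a}) if and only if T₂₁ = T₁₂ − a·T₁₃, T₃₁ = a·T₁₂ + T₁₃, and T₃₂ = a·(T₂₂ + T₃₃) + T₂₃. In particular HL(μ_{1;a}) is a 6-dimensional linear subspace of End(ℂ³). -/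
noncomputable section
open Matrix

theorem one_add_sq_ne_zero {a : ℂ} (hi : a ≠ Complex.I) (hni : a ≠ -Complex.I) :
    1 + a ^ 2 ≠ 0 := by
  intro h
  have h' : (a - Complex.I) * (a + Complex.I) = 0 := by
    linear_combination h - Complex.I_sq
  rcases mul_eq_zero.mp h' with h' | h'
  · exact hi (sub_eq_zero.mp h')
  · exact hni (eq_neg_of_add_eq_zero_left h')

theorem HL_Mone_iff {a : ℂ} (h : 1 + a ^ 2 ≠ 0) (T : Mat3) :
    HL (prodOf (Mone a)) T ↔
      (T 1 0 = T 0 1 - a * T 0 2 ∧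
       T 2 0 = a * T 0 1 + T 0 2 ∧
       T 2 1 = a * (T 1 1 + T 2 2) + T 1 2) := by
  constructor
  · intro hT
    have key := hT ![1, 0, 0] ![0, 1, 0] ![0, 0, 1]
    have k0 := congrFun key 0
    have k1 := congrFun key 1
    have k2 := congrFun key 2
    simp [prodOf, Mone, cross3, mulVec, dotProduct, Fin.sum_univ_three] at k0 k1 k2
    refine ⟨?_, ?_, ?_⟩
    · apply mul_left_cancel₀ h
      linear_combination -k2 + a * k1
    · apply mul_left_cancel₀ h
      linear_combination k1 + a * k2
    · linear_combination -k0
  · rintro ⟨h1, h2, h3⟩ x y z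
    ext i
    fin_cases i <;>
    · simp [prodOf, Mone, cross3, mulVec, dotProduct, Fin.sum_univ_three, h1, h2, h3]
      ring

/-- The solution space of the linear equations describing `HL (prodOf (Mone a))`. -/
def homLieSubmodule (a : ℂ) : Submodule ℂ Mat3 where
  carrier := {T | T 1 0 = T 0 1 - a * T 0 2 ∧
    T 2 0 = a * T 0 1 + T 0 2 ∧ T 2 1 = a * (T 1 1 + T 2 2) + T 1 2}
  zero_mem' := by simp
  add_mem' := by
    rintro A B ⟨a1, a2, a3⟩ ⟨b1, b2, b3⟩
    refine ⟨?_, ?_, ?_⟩ <;> simp only [Matrix.add_apply]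
    · linear_combination a1 + b1
    · linear_combination a2 + b2
    · linear_combination a3 + b3
  smul_mem' := by
    rintro c A ⟨a1, a2, a3⟩
    refine ⟨?_, ?_, ?_⟩ <;> simp only [Matrix.smul_apply, smul_eq_mul]
    · linear_combination c * a1
    · linear_combination c * a2
    · linear_combination c * a3

/-- The upper triangular entries are coordinates on `homLieSubmodule a`. -/
def homLieSubmoduleEquiv (a : ℂ) : homLieSubmodule a ≃ₗ[ℂ] (Fin 6 → ℂ) where
  toFun T := ![T.1 0 0, T.1 0 1, T.1 0 2, T.1 1 1, T.1 1 2, T.1 2 2]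
  map_add' A B := by
    ext i
    fin_cases i <;> simp
  map_smul' c A := by
    ext i
    fin_cases i <;> simp
  invFun v := ⟨!![v 0, v 1, v 2;
    v 1 - a * v 2, v 3, v 4;
    a * v 1 + v 2, a * (v 3 + v 5) + v 4, v 5], by simp [homLieSubmodule]⟩
  left_inv := by
    rintro ⟨T, h1, h2, h3⟩
    ext i j
    fin_cases i <;> fin_cases j <;> simp [h1, h2, h3]
  right_inv v := by
    ext i
    fin_cases i <;> simp

theorem stmt5 (a : ℂ) (ha : a ≠ 0) (hi : a ≠ Complex.I) (hni : a ≠ -Complex.I) :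
    (∀ T : Mat3, HL (prodOf (Mone a)) T ↔
      (T 1 0 = T 0 1 - a * T 0 2 ∧
       T 2 0 = a * T 0 1 + T 0 2 ∧
       T 2 1 = a * (T 1 1 + T 2 2) + T 1 2)) ∧
    (∃ S : Submodule ℂ Mat3, (∀ T, T ∈ S ↔ HL (prodOf (Mone a)) T) ∧
      Module.finrank ℂ S = 6) := by
  have h := one_add_sq_ne_zero hi hni
  refine ⟨HL_Mone_iff h, homLieSubmodule a, fun T => (HL_Mone_iff h T).symm, ?_⟩
  rw [(homLieSubmoduleEquiv a).finrank_eq, Module.finrank_fin_fun]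
end
end

section
/- Let sl₂ = ℂ³ with basis H = e₁, E = e₂, F = e₃ and Lie bracket μ₂ given by μ₂(H,E) = 2E, μ₂(H,F) = −2F, μ₂(E,F) = H. Then a linear map T = (T_{ij}) belongs to HL(μ₂) if and only if T₂₁ = 2·T₁₃, T₃₁ = 2·T₁₂, and T₃₃ = T₂₂. In particular, HL(μ₂) is a 6-dimensional subspace of End(ℂ³) and decomposes as HL(μ₂) = SHL(μ₂) ⊕ ℂ·Id, where SHL(μ₂) = {T ∈ HL(μ₂) : Tr(T) = 0}. -/
noncomputable section
open Matrix

/-- The matrix of the `sl₂` bracket `μ₂`: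
`μ₂(H,E) = 2E`, `μ₂(H,F) = -2F`, `μ₂(E,F) = H`, with `H = e₁`, `E = e₂`, `F = e₃`. -/
def Msl2 : Mat3 := !![1, 0, 0; 0, 0, 2; 0, 2, 0]

theorem HL_Msl2_iff (T : Mat3) : HL (prodOf Msl2) T ↔
    (T 1 0 = 2 * T 0 2 ∧ T 2 0 = 2 * T 0 1 ∧ T 2 2 = T 1 1) := by
  constructor
  · intro h
    have h' := h ![1, 0, 0] ![0, 1, 0] ![0, 0, 1]
    have h0 := congrFun h' 0
    have h1 := congrFun h' 1
    have h2 := congrFun h' 2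
    simp [prodOf, cross3, Msl2, mulVec, dotProduct, Fin.sum_univ_three] at h0 h1 h2
    refine ⟨?_, ?_, ?_⟩
    · linear_combination (-1 / 2) * h1
    · linear_combination (1 / 2) * h2
    · linear_combination (-1 / 2) * h0
  · rintro ⟨h1, h2, h3⟩ x y z
    ext i
    fin_cases i <;>
      simp [prodOf, cross3, Msl2, mulVec, dotProduct, Fin.sum_univ_three, h1, h2, h3] <;> ring

/-- The space `HL(μ₂)`, cut out by its linear equations. -/
def HLsl2 : Submodule ℂ Mat3 where
  carrier := {T | T 1 0 = 2 * T 0 2 ∧ T 2 0 = 2 * T 0 1 ∧ T 2 2 = T 1 1}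
  zero_mem' := by simp
  add_mem' := by
    rintro A B ⟨h1, h2, h3⟩ ⟨k1, k2, k3⟩
    simp only [Set.mem_ofPred_eq, Matrix.add_apply, h1, h2, h3, k1, k2, k3, mul_add, and_self]
  smul_mem' := by
    rintro c A ⟨h1, h2, h3⟩
    simp only [Set.mem_ofPred_eq, Matrix.smul_apply, smul_eq_mul, h1, h2, h3, mul_left_comm, and_self]

/-- The six free matrix entries are coordinates on `HL(μ₂)`. -/
def HLsl2Equiv : HLsl2 ≃ₗ[ℂ] (Fin 6 → ℂ) where
  toFun T := ![T.1 0 0, T.1 0 1, T.1 0 2, T.1 1 1, T.1 1 2, T.1 2 1]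
  invFun v := ⟨!![v 0, v 1, v 2; 2 * v 2, v 3, v 4; 2 * v 1, v 5, v 3], by simp [HLsl2]⟩
  map_add' A B := by
    ext i
    fin_cases i <;> rfl
  map_smul' c A := by
    ext i
    fin_cases i <;> rfl
  left_inv := by
    rintro ⟨T, h1, h2, h3⟩
    ext i j
    fin_cases i <;> fin_cases j <;> simp [h1, h2, h3]
  right_inv v := by
    ext i
    fin_cases i <;> rfl

theorem finrank_HLsl2 : Module.finrank ℂ HLsl2 = 6 := by
  rw [HLsl2Equiv.finrank_eq, Module.finrank_fin_fun]

theorem one_mem_HLsl2 : (1 : Mat3) ∈ HLsl2 := by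
  simp [HLsl2]

theorem stmt9 :
    (∀ T : Mat3, HL (prodOf Msl2) T ↔
      (T 1 0 = 2 * T 0 2 ∧ T 2 0 = 2 * T 0 1 ∧ T 2 2 = T 1 1)) ∧
    (∃ S : Submodule ℂ Mat3, (∀ T, T ∈ S ↔ HL (prodOf Msl2) T) ∧
      Module.finrank ℂ S = 6) ∧
    (∀ T : Mat3, HL (prodOf Msl2) T →
      ∃! pc : Mat3 × ℂ,
        HL (prodOf Msl2) pc.1 ∧ pc.1.trace = 0 ∧ T = pc.1 + pc.2 • (1 : Mat3)) := by
  refine ⟨HL_Msl2_iff, ⟨HLsl2, fun T => (HL_Msl2_iff T).symm, finrank_HLsl2⟩, fun T hT => ?_⟩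
  refine ⟨(T - (T.trace / 3) • (1 : Mat3), T.trace / 3), ⟨?_, ?_, ?_⟩, ?_⟩
  · exact (HL_Msl2_iff _).2
      (HLsl2.sub_mem ((HL_Msl2_iff T).1 hT) (HLsl2.smul_mem _ one_mem_HLsl2))
  · simp [trace_sub, trace_smul]
  · simp
  · rintro ⟨P, c⟩ ⟨-, hP, rfl⟩
    have hP' : P.trace = 0 := hP
    simp [trace_add, trace_smul, hP']
end
end

section
/- Let μ₃ be the product on ℂ³ given by μ₃(e₁,e₂) = 2e₂, μ₃(e₂,e₃) = e₁ − e₂, μ₃(e₃,e₁) = 2e₃. Then a linear map T = (T_{ij}) belongs to HL(μ₃) if and only if T₂₁ = −T₁₁ + 2·T₁₃, T₃₁ = 2·T₁₂, and T₃₃ = T₂₂ + T₁₂. In particular HL(μ₃) is a 6-dimensional linear subspace of End(ℂ³). -/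
noncomputable section
open Matrix

/-- The matrix of the product `μ₃`:
`μ₃(e₁,e₂) = 2e₂`, `μ₃(e₂,e₃) = e₁ - e₂`, `μ₃(e₃,e₁) = 2e₃`. -/
def Mmu3 : Mat3 := !![1, 0, 0; -1, 0, 2; 0, 2, 0]

/-- A map satisfies the Hom-Lie Jacobi identity for `μ₃` iff three linear relations hold. -/
theorem hl_Mmu3_iff (T : Mat3) : HL (prodOf Mmu3) T ↔
    (T 1 0 = -T 0 0 + 2 * T 0 2 ∧ T 2 0 = 2 * T 0 1 ∧ T 2 2 = T 1 1 + T 0 1) := by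
  constructor
  · intro h
    have key := h ![1, 0, 0] ![0, 1, 0] ![0, 0, 1]
    have h0 := congrFun key 0
    have h1 := congrFun key 1
    have h2 := congrFun key 2
    simp [prodOf, cross3, Mmu3, Matrix.mulVec, dotProduct, Fin.sum_univ_three] at h0 h1 h2
    refine ⟨?_, ?_, ?_⟩
    · grind
    · grind
    · grind
  · rintro ⟨h0, h1, h2⟩ x y z
    ext i
    fin_cases i <;>
      simp [prodOf, cross3, Mmu3, Matrix.mulVec, dotProduct, Fin.sum_univ_three, h0, h1, h2] <;>
      ring

/-- The linear map whose kernel is `HL(μ₃)`. -/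
def hlDefect : Mat3 →ₗ[ℂ] V3 where
  toFun T := ![T 1 0 - (-T 0 0 + 2 * T 0 2), T 2 0 - 2 * T 0 1, T 2 2 - (T 1 1 + T 0 1)]
  map_add' A B := by
    ext i
    fin_cases i <;> simp <;> ring
  map_smul' c A := by
    ext i
    fin_cases i <;> simp <;> ring

theorem mem_ker_hlDefect (T : Mat3) :
    T ∈ LinearMap.ker hlDefect ↔ HL (prodOf Mmu3) T := by
  rw [hl_Mmu3_iff, LinearMap.mem_ker, funext_iff, Fin.forall_fin_succ, Fin.forall_fin_two]
  simp [hlDefect, sub_eq_zero]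

theorem hlDefect_surjective : Function.Surjective hlDefect := by
  intro v
  refine ⟨!![0, 0, 0; v 0, 0, 0; v 1, 0, v 2], ?_⟩
  ext i
  fin_cases i <;> simp [hlDefect]

theorem finrank_ker_hlDefect : Module.finrank ℂ (LinearMap.ker hlDefect) = 6 := by
  have h := LinearMap.finrank_range_add_finrank_ker hlDefect
  rw [LinearMap.range_eq_top.2 hlDefect_surjective, finrank_top, Module.finrank_matrix] at h
  simp at h
  omega

theorem stmt12 :
    (∀ T : Mat3, HL (prodOf Mmu3) T ↔
      (T 1 0 = -T 0 0 + 2 * T 0 2 ∧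
       T 2 0 = 2 * T 0 1 ∧
       T 2 2 = T 1 1 + T 0 1)) ∧
    (∃ S : Submodule ℂ Mat3, (∀ T, T ∈ S ↔ HL (prodOf Mmu3) T) ∧
      Module.finrank ℂ S = 6) := by
  exact ⟨hl_Mmu3_iff, LinearMap.ker hlDefect, mem_ker_hlDefect, finrank_ker_hlDefect⟩
end
end

section
/- Let μ″₁ be the product on ℂ³ given by μ″₁(e₁,e₂) = e₂, μ″₁(e₂,e₃) = e₁, μ″₁(e₃,e₁) = e₂ − e₃. Then a linear map T = (T_{ij}) belongs to HL(μ″₁) if and only if T₂₁ = T₁₂ + T₁₃, T₃₁ = −T₁₂, and T₃₂ = −(T₂₂ + T₃₃). Moreover, if (T₂₂, T₃₃) ≠ (0,0), then T is equivalent under the G_{μ″₁}-action T ↦ g∘T∘g⁻¹ to some T′ ∈ HL(μ″₁) with T′₂₃ = 0 and (T′₂₂, T′₃₃) ≠ (0,0); and if T₂₂ = T₃₃ = 0, then automatically T₃₂ = 0. -/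
noncomputable section
open Matrix

/-- The matrix of the product `μ″₁`:
`μ″₁(e₁,e₂) = e₂`, `μ″₁(e₂,e₃) = e₁`, `μ″₁(e₃,e₁) = e₂ - e₃`. -/
def Md21 : Mat3 := !![1, 0, 0; 0, 1, 1; 0, -1, 0]

theorem hl_prodOf_Md21_iff (T : Mat3) : HL (prodOf Md21) T ↔
    (T 1 0 = T 0 1 + T 0 2 ∧ T 2 0 = -T 0 1 ∧ T 2 1 = -(T 1 1 + T 2 2)) := by
  constructor
  · intro h
    have hb := h ![1, 0, 0] ![0, 1, 0] ![0, 0, 1]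
    have h0 := congrFun hb 0
    have h1 := congrFun hb 1
    have h2 := congrFun hb 2
    simp [prodOf, cross3, Md21, Matrix.mulVec, dotProduct, Fin.sum_univ_three] at h0 h1 h2
    refine ⟨?_, ?_, ?_⟩
    · linear_combination -h1 - h2
    · linear_combination -h2
    · linear_combination -h0
  · rintro ⟨h1, h2, h3⟩ x y z
    ext i
    fin_cases i <;>
      simp [prodOf, cross3, Md21, Matrix.mulVec, dotProduct, Fin.sum_univ_three, h1, h2, h3] <;>
      ring

/-- The shear `e₃ ↦ e₃ + t e₂`. -/
def shear (t : ℂ) : Mat3 := !![1, 0, 0; 0, 1, t; 0, 0, 1]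

theorem det_shear (t : ℂ) : (shear t).det = 1 := by
  simp [shear, Matrix.det_fin_three]

theorem shear_inv (t : ℂ) : (shear t)⁻¹ = shear (-t) := by
  apply Matrix.inv_eq_right_inv
  ext i j
  fin_cases i <;> fin_cases j <;> simp [shear, Matrix.mul_apply, Fin.sum_univ_three]

theorem isAut_shear (t : ℂ) : IsAut (prodOf Md21) (shear t) := by
  refine ⟨by simp [det_shear], fun x y => ?_⟩
  ext i
  fin_cases i <;>
    simp [prodOf, cross3, Md21, shear, Matrix.mulVec, dotProduct, Fin.sum_univ_three] <;> ring

theorem shear_conj_apply (T : Mat3) (t : ℂ) :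
    (shear t * T * (shear t)⁻¹) 1 1 = T 1 1 + t * T 2 1 ∧
    (shear t * T * (shear t)⁻¹) 1 2 = T 1 2 + t * (T 2 2 - T 1 1) - t ^ 2 * T 2 1 ∧
    (shear t * T * (shear t)⁻¹) 2 2 = T 2 2 - t * T 2 1 := by
  rw [shear_inv]
  simp only [Matrix.mul_apply, Fin.sum_univ_three]
  refine ⟨?_, ?_, ?_⟩ <;> simp [shear] <;> ring

theorem exists_shear_parameter {p s : ℂ} (q : ℂ) (h : (p, s) ≠ (0, 0)) :
    ∃ t : ℂ, (p + s) * (t * t) + (s - p) * t + q = 0 := by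
  by_cases hr : p + s = 0
  · have hs : s = -p := by linear_combination hr
    have hp : p ≠ 0 := by
      rintro rfl
      exact h (by simp [hs])
    refine ⟨q / (2 * p), ?_⟩
    subst hs
    field_simp
    ring
  · obtain ⟨w, hw⟩ := IsAlgClosed.exists_pow_nat_eq (discrim (p + s) (s - p) q) two_pos
    exact exists_quadratic_eq_zero hr ⟨w, by rw [← hw, sq]⟩

theorem stmt13 :
    (∀ T : Mat3, HL (prodOf Md21) T ↔
      (T 1 0 = T 0 1 + T 0 2 ∧ T 2 0 = -T 0 1 ∧ T 2 1 = -(T 1 1 + T 2 2))) ∧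
    (∀ T : Mat3, HL (prodOf Md21) T → (T 1 1, T 2 2) ≠ (0, 0) →
      ∃ T' : Mat3, HLequiv (prodOf Md21) T T' ∧ T' 1 2 = 0 ∧ (T' 1 1, T' 2 2) ≠ (0, 0)) ∧
    (∀ T : Mat3, HL (prodOf Md21) T → T 1 1 = 0 → T 2 2 = 0 → T 2 1 = 0) := by
  refine ⟨hl_prodOf_Md21_iff, fun T hT hne => ?_, fun T hT h1 h2 => ?_⟩
  · obtain ⟨-, -, h21⟩ := (hl_prodOf_Md21_iff T).1 hT
    obtain ⟨t, ht⟩ := exists_shear_parameter (T 1 2) hne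
    obtain ⟨h11', h12', h22'⟩ := shear_conj_apply T t
    refine ⟨shear t * T * (shear t)⁻¹, ⟨shear t, isAut_shear t, rfl⟩, ?_, ?_⟩
    · rw [h12', h21]
      linear_combination ht
    · rw [h11', h22', h21]
      intro h
      obtain ⟨ha, hb⟩ := Prod.ext_iff.1 h
      dsimp only at ha hb
      have hsum : T 1 1 + T 2 2 = 0 := by linear_combination ha + hb
      refine hne (Prod.ext ?_ ?_)
      · linear_combination ha + t * hsum
      · linear_combination hb - t * hsum
  · simp [((hl_prodOf_Md21_iff T).1 hT).2.2, h1, h2]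
end
end

section
/- Let μ″₃ be the product on ℂ³ given by μ″₃(e₁,e₂) = e₂, μ″₃(e₂,e₃) = −2e₂, μ″₃(e₃,e₁) = e₃. Then a linear map T = (T_{ij}) belongs to HL(μ″₃) if and only if T₁₂ = 0 and 2·T₁₁ + 2·T₂₂ − 2·T₃₃ + 4·T₃₁ − T₁₃ = 0. In particular HL(μ″₃) is a 7-dimensional linear subspace of End(ℂ³). -/
noncomputable section
open Matrix

/-- The matrix of the product `μ″₃`:
`μ″₃(e₁,e₂) = e₂`, `μ″₃(e₂,e₃) = -2e₂`, `μ″₃(e₃,e₁) = e₃`. -/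
def Md23 : Mat3 := !![0, 0, 0; -2, 0, 1; 0, 1, 0]

/-- The left-hand side of the Hom-Lie Jacobi identity for `μ″₃` is the determinant of the three
arguments times a fixed vector. -/
theorem jacobiator_Md23 (T : Mat3) (x y z : V3) :
    prodOf Md23 (T.mulVec x) (prodOf Md23 y z) + prodOf Md23 (T.mulVec y) (prodOf Md23 z x) +
      prodOf Md23 (T.mulVec z) (prodOf Md23 x y) =
    (x 0 * (y 1 * z 2 - y 2 * z 1) + x 1 * (y 2 * z 0 - y 0 * z 2) +
      x 2 * (y 0 * z 1 - y 1 * z 0)) •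
    ![0, -(2 * T 0 0 + 2 * T 1 1 - 2 * T 2 2 + 4 * T 2 0 - T 0 2), -T 0 1] := by
  ext i
  fin_cases i <;>
  · simp [prodOf, Md23, cross3, Matrix.mulVec, dotProduct, Fin.sum_univ_three]
    try ring

theorem HL_Md23_iff (T : Mat3) : HL (prodOf Md23) T ↔
    (T 0 1 = 0 ∧ 2 * T 0 0 + 2 * T 1 1 - 2 * T 2 2 + 4 * T 2 0 - T 0 2 = 0) := by
  simp only [HL, jacobiator_Md23]
  constructor
  · intro h
    have h' := h ![1, 0, 0] ![0, 1, 0] ![0, 0, 1]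
    have h1 := congrFun h' 1
    have h2 := congrFun h' 2
    simp only [Pi.smul_apply, Pi.zero_apply, smul_eq_mul, Matrix.cons_val] at h1 h2
    constructor
    · linear_combination -h2
    · linear_combination -h1
  · rintro ⟨h1, h2⟩ x y z
    rw [h1, h2]
    ext i
    fin_cases i <;> simp

/-- The two linear equations cutting out `HL(μ″₃)`. -/
def equationsMd23 : Mat3 →ₗ[ℂ] ℂ × ℂ where
  toFun T := (T 0 1, 2 * T 0 0 + 2 * T 1 1 - 2 * T 2 2 + 4 * T 2 0 - T 0 2)
  map_add' A B := by
    ext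
    · simp
    · simp only [Matrix.add_apply, Prod.snd_add]
      ring
  map_smul' c A := by
    ext
    · simp
    · simp only [Matrix.smul_apply, Prod.smul_snd, smul_eq_mul, RingHom.id_apply]
      ring

theorem equationsMd23_surjective : Function.Surjective equationsMd23 := fun p =>
  ⟨!![0, p.1, -p.2; 0, 0, 0; 0, 0, 0], by ext <;> simp [equationsMd23]⟩

theorem stmt15 :
    (∀ T : Mat3, HL (prodOf Md23) T ↔
      (T 0 1 = 0 ∧
       2 * T 0 0 + 2 * T 1 1 - 2 * T 2 2 + 4 * T 2 0 - T 0 2 = 0)) ∧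
    (∃ S : Submodule ℂ Mat3, (∀ T, T ∈ S ↔ HL (prodOf Md23) T) ∧
      Module.finrank ℂ S = 7) := by
  refine ⟨HL_Md23_iff, LinearMap.ker equationsMd23, fun T => ?_, ?_⟩
  · rw [HL_Md23_iff, LinearMap.mem_ker]
    exact Prod.ext_iff
  · have h := equationsMd23.finrank_range_add_finrank_ker
    rw [LinearMap.range_eq_top.mpr equationsMd23_surjective, finrank_top,
      Module.finrank_prod, Module.finrank_self, Module.finrank_matrix,
      Module.finrank_self, Fintype.card_fin] at h
    omega
end
end

section
/- Let μ′₁ be the product on ℂ³ given by μ′₁(e₁,e₂) = e₂, μ′₁(e₂,e₃) = e₁, μ′₁(e₃,e₁) = −e₃. Then a linear map T = (T_{ij}) belongs to HL(μ′₁) if and only if T₂₁ = T₁₃, T₃₁ = −T₁₂, and T₃₃ = −T₂₂. Moreover, writing Θ = [[T₂₂,T₂₃],[T₃₂,−T₂₂]] for the lower-right 2×2 block of such a T, T is equivalent under the G_{μ′₁}-action T ↦ g∘T∘g⁻¹ to one of the following canonical forms: (1) if det(Θ) = 0, to [[p,b,c],[c,0,s],[−b,0,0]]; (2) if det(Θ)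 ≠ 0, to [[p,b,c],[c,q,0],[−b,0,−q]] with q ≠ 0. -/
noncomputable section
open Matrix

/-- The matrix of the product `μ′₁`:
`μ′₁(e₁,e₂) = e₂`, `μ′₁(e₂,e₃) = e₁`, `μ′₁(e₃,e₁) = -e₃`. -/
def Md11 : Mat3 := !![1, 0, 0; 0, 0, 1; 0, -1, 0]

theorem HL_prodOf_Md11_iff (T : Mat3) : HL (prodOf Md11) T ↔
    (T 1 0 = T 0 2 ∧ T 2 0 = -T 0 1 ∧ T 2 2 = -T 1 1) := by
  constructor
  · intro h
    have h' := h ![1, 0, 0] ![0, 1, 0] ![0, 0, 1]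
    have h0 := congrFun h' 0
    have h1 := congrFun h' 1
    have h2 := congrFun h' 2
    simp [prodOf, Md11, cross3, Matrix.mulVec, dotProduct, Fin.sum_univ_three] at h0 h1 h2
    refine ⟨?_, ?_, ?_⟩ <;> grind
  · rintro ⟨h1, h2, h3⟩ x y z
    ext i
    fin_cases i <;>
      simp [prodOf, Md11, cross3, Matrix.mulVec, dotProduct, Fin.sum_univ_three, h1, h2, h3] <;>
      ring

/-- The block matrix `diag(1, A)` with `A = !![u, v; w, z]`. -/
def oneBlock (u v w z : ℂ) : Mat3 := !![1, 0, 0; 0, u, v; 0, w, z]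

theorem det_oneBlock (u v w z : ℂ) : (oneBlock u v w z).det = u * z - v * w := by
  simp [oneBlock, Matrix.det_fin_three]

theorem isAut_oneBlock {u v w z : ℂ} (h : u * z - v * w = 1) :
    IsAut (prodOf Md11) (oneBlock u v w z) := by
  refine ⟨by simp [det_oneBlock, h], fun x y => ?_⟩
  ext i
  fin_cases i <;>
    simp [oneBlock, prodOf, Md11, cross3, Matrix.mulVec, dotProduct, Fin.sum_univ_three]
  · linear_combination (-(x 1 * y 2 - x 2 * y 1)) * h
  · ring
  · ring

/-- If the unimodular matrix `A = !![u, v; w, z]` conjugates the lower-right block of `T` to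
`!![q, s; 0, -q]`, then `diag(1, A)` conjugates `T` to the corresponding triangular form. -/
theorem exists_HLequiv_of_block {T : Mat3} (hT : HL (prodOf Md11) T) {u v w z q s : ℂ}
    (h : u * z - v * w = 1)
    (h11 : u * T 1 1 + v * T 2 1 = q * u + s * w)
    (h12 : u * T 1 2 - v * T 1 1 = q * v + s * z)
    (h21 : w * T 1 1 + z * T 2 1 = -q * w)
    (h22 : w * T 1 2 - z * T 1 1 = -q * z) :
    ∃ p b c : ℂ, HLequiv (prodOf Md11) T !![p, b, c; c, q, s; -b, 0, -q] := by
  obtain ⟨t1, t2, t3⟩ := (HL_prodOf_Md11_iff T).1 hT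
  refine ⟨T 0 0, T 0 1 * z - T 0 2 * w, T 0 2 * u - T 0 1 * v, oneBlock u v w z,
    isAut_oneBlock h, ?_⟩
  have hu : IsUnit (oneBlock u v w z).det := by simp [det_oneBlock, h]
  have key : !![T 0 0, T 0 1 * z - T 0 2 * w, T 0 2 * u - T 0 1 * v;
      T 0 2 * u - T 0 1 * v, q, s; -(T 0 1 * z - T 0 2 * w), 0, -q] * oneBlock u v w z =
      oneBlock u v w z * T := by
    ext i j
    fin_cases i <;> fin_cases j <;>
      simp [oneBlock, Matrix.mul_apply, Fin.sum_univ_three, t1, t2, t3] <;> grind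
  rw [← key, Matrix.mul_nonsing_inv_cancel_right _ _ hu]

theorem stmt17 :
    (∀ T : Mat3, HL (prodOf Md11) T ↔
      (T 1 0 = T 0 2 ∧ T 2 0 = -T 0 1 ∧ T 2 2 = -T 1 1)) ∧
    (∀ T : Mat3, HL (prodOf Md11) T →
      ((T 1 1 * T 2 2 - T 1 2 * T 2 1 = 0 →
        ∃ p b c s : ℂ, HLequiv (prodOf Md11) T !![p, b, c; c, 0, s; -b, 0, 0]) ∧
       (T 1 1 * T 2 2 - T 1 2 * T 2 1 ≠ 0 →
        ∃ p b c q : ℂ, q ≠ 0 ∧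
          HLequiv (prodOf Md11) T !![p, b, c; c, q, 0; -b, 0, -q]))) := by
  refine ⟨HL_prodOf_Md11_iff, fun T hT => ?_⟩
  obtain ⟨-, -, t3⟩ := (HL_prodOf_Md11_iff T).1 hT
  rw [t3]
  refine ⟨fun hd => ?_, fun hd => ?_⟩
  · suffices ∃ u v w z s : ℂ, u * z - v * w = 1 ∧
        u * T 1 1 + v * T 2 1 = 0 * u + s * w ∧ u * T 1 2 - v * T 1 1 = 0 * v + s * z ∧
        w * T 1 1 + z * T 2 1 = -0 * w ∧ w * T 1 2 - z * T 1 1 = -0 * z by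
      obtain ⟨u, v, w, z, s, h, h11, h12, h21, h22⟩ := this
      obtain ⟨p, b, c, H⟩ := exists_HLequiv_of_block hT h h11 h12 h21 h22
      exact ⟨p, b, c, s, by simpa using H⟩
    by_cases hc : T 2 1 = 0
    · have ha : T 1 1 = 0 := by simpa [hc] using hd
      exact ⟨1, 0, 0, 1, T 1 2, by simp [hc, ha]⟩
    · refine ⟨0, -(T 2 1)⁻¹, T 2 1, -T 1 1, -(T 2 1)⁻¹, ?_, ?_, ?_, ?_, ?_⟩ <;> grind
  · suffices ∃ u v w z q : ℂ, q ≠ 0 ∧ u * z - v * w = 1 ∧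
        u * T 1 1 + v * T 2 1 = q * u + 0 * w ∧ u * T 1 2 - v * T 1 1 = q * v + 0 * z ∧
        w * T 1 1 + z * T 2 1 = -q * w ∧ w * T 1 2 - z * T 1 1 = -q * z by
      obtain ⟨u, v, w, z, q, hq, h, h11, h12, h21, h22⟩ := this
      obtain ⟨p, b, c, H⟩ := exists_HLequiv_of_block hT h h11 h12 h21 h22
      exact ⟨p, b, c, q, hq, H⟩
    by_cases hc : T 2 1 = 0
    · have ha : T 1 1 ≠ 0 := fun ha => hd (by simp [hc, ha])
      refine ⟨1, T 1 2 / (2 * T 1 1), 0, 1, T 1 1, ha, ?_, ?_, ?_, ?_, ?_⟩ <;>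
        simp [hc]
      field_simp
      ring
    · obtain ⟨q, hq⟩ := IsAlgClosed.exists_pow_nat_eq (T 1 1 ^ 2 + T 1 2 * T 2 1) two_pos
      have hq0 : q ≠ 0 := by
        rintro rfl
        exact hd (by linear_combination hq)
      refine ⟨-1 / (2 * q), -(q - T 1 1) / (2 * q * T 2 1), T 2 1, -q - T 1 1, q, hq0,
        ?_, ?_, ?_, ?_, ?_⟩ <;> field_simp <;> grind
end
end

section
/- Let μ′₂ be the Heisenberg product on ℂ³ given by μ′₂(e₂,e₃) = e₁, μ′₂(e₁,e₂) = 0, μ′₂(e₃,e₁) = 0. Then HL(μ′₂) = End(ℂ³): every linear map T : ℂ³ → ℂ³ satisfies the Hom-Lie Jacobi identity for μ′₂. Moreover, writing Θ = [[T₂₂,T₂₃],[T₃₂,T₃₃]] for the lower-right 2×2 block, every T = (T_{ij}) is equivalent under the G_{μ′₂}-action T ↦ g∘T∘g⁻¹ to one of the following canonical forms: (1) if (T₂₁,T₃₁) ≠ (0,0), to [[p,b,c],[u,q,0],[w,0,0]] with (u,w) ≠ (0,0); (2) if (T₂₁,T₃₁) = (0,0) and det(Θ − T₁₁·1₂) ≠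 0, to [[p,0,0],[0,q,s],[0,0,r]] with (q−p)·(r−p) ≠ 0; (3) if (T₂₁,T₃₁) = (0,0) and det(Θ − T₁₁·1₂) = 0, to an upper-triangular form [[p,b,c],[0,q,s],[0,0,r]] with (q−p)·(r−p) = 0. -/
noncomputable section
open Matrix

/-- The matrix of the Heisenberg product `μ′₂`:
`μ′₂(e₂,e₃) = e₁`, `μ′₂(e₁,e₂) = 0`, `μ′₂(e₃,e₁) = 0`. -/
def Md12 : Mat3 := !![1, 0, 0; 0, 0, 0; 0, 0, 0]

/-- The lower-right `2×2` block `Θ` of `T`. -/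
def thetaLR (T : Mat3) : Matrix (Fin 2) (Fin 2) ℂ := !![T 1 1, T 1 2; T 2 1, T 2 2]

/-- Every matrix preserving the flag structure `⟨e₁⟩`, and acting on `⟨e₁⟩` by the determinant of the
induced map on the quotient, is an automorphism of the Heisenberg product. -/
lemma isAut_heisenberg {a b c d : ℂ} (x y : ℂ) (h : a * d - b * c ≠ 0) :
    IsAut (prodOf Md12) !![a * d - b * c, x, y; 0, a, b; 0, c, d] := by
  refine ⟨?_, fun v w => ?_⟩
  · rw [Matrix.det_fin_three]
    simpa [mul_assoc, ← mul_sub] using h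
  · ext i
    fin_cases i <;>
      simp [prodOf, Md12, cross3, Matrix.mulVec, dotProduct, Fin.sum_univ_three]
    ring

/-- An intertwining automorphism yields an equivalence. -/
lemma hlequiv_of_intertwine {T T' : Mat3} {a b c d : ℂ} (x y : ℂ) (h : a * d - b * c ≠ 0)
    (hT : !![a * d - b * c, x, y; 0, a, b; 0, c, d] * T =
      T' * !![a * d - b * c, x, y; 0, a, b; 0, c, d]) :
    HLequiv (prodOf Md12) T T' := by
  have hg := isAut_heisenberg x y h
  refine ⟨_, hg, ?_⟩
  rw [hT, Matrix.mul_nonsing_inv_cancel_right _ _ (isUnit_iff_ne_zero.mpr hg.1)]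

lemma HLequiv.trans {μ : V3 → V3 → V3} {A B C : Mat3} (h₁ : HLequiv μ A B)
    (h₂ : HLequiv μ B C) : HLequiv μ A C := by
  obtain ⟨g, ⟨hg, hgμ⟩, rfl⟩ := h₁
  obtain ⟨k, ⟨hk, hkμ⟩, rfl⟩ := h₂
  refine ⟨k * g, ⟨?_, fun x y => ?_⟩, ?_⟩
  · rw [Matrix.det_mul]
    exact mul_ne_zero hk hg
  · simp only [← Matrix.mulVec_mulVec, hgμ, hkμ]
  · rw [Matrix.mul_inv_rev]
    simp only [Matrix.mul_assoc]

/-- Triangularization of the lower-right block when the lower-left block vanishes. -/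
lemma exists_hlequiv_upperTriangular (p b c m n k l : ℂ) :
    ∃ b' c' q s r : ℂ, (b = 0 → c = 0 → b' = 0 ∧ c' = 0) ∧
      (q - p) * (r - p) = (m - p) * (l - p) - n * k ∧
      HLequiv (prodOf Md12) !![p, b, c; 0, m, n; 0, k, l] !![p, b', c'; 0, q, s; 0, 0, r] := by
  by_cases hk : k = 0
  · subst hk
    refine ⟨b, c, m, n, l, fun hb hc => ⟨hb, hc⟩, by ring, ?_⟩
    refine hlequiv_of_intertwine (a := 1) (b := 0) (c := 0) (d := 1) 0 0 (by simp) ?_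
    ext i j
    fin_cases i <;> fin_cases j <;> simp [Matrix.mul_apply, Fin.sum_univ_three]
  · obtain ⟨t, ht⟩ := IsAlgClosed.exists_pow_nat_eq ((m - l) ^ 2 + 4 * (n * k)) two_pos
    obtain ⟨r, hr⟩ : ∃ r : ℂ, (r - m) * (r - l) = n * k :=
      ⟨(m + l + t) / 2, by linear_combination ht / 4⟩
    refine ⟨-k * c + b * (r - m), -b, m + l - r, 1, r, ?_, by linear_combination -hr, ?_⟩
    · rintro rfl rfl
      simp
    · refine hlequiv_of_intertwine (a := 0) (b := 1) (c := k) (d := r - m) 0 0 (by simpa) ?_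
      ext i j
      fin_cases i <;> fin_cases j <;> simp [Matrix.mul_apply, Fin.sum_univ_three]
      all_goals first | ring1 | linear_combination -hr

/-- If `Θ - p` is invertible, a shear kills the remaining entries of the first row. -/
lemma hlequiv_blockDiagonal (p b c m n k l : ℂ) (hD : (m - p) * (l - p) - n * k ≠ 0) :
    HLequiv (prodOf Md12) !![p, b, c; 0, m, n; 0, k, l] !![p, 0, 0; 0, m, n; 0, k, l] := by
  obtain ⟨x, y, hx, hy⟩ : ∃ x y : ℂ, x * (m - p) + y * k = -b ∧ x * n + y * (l - p) = -c := by
    refine ⟨(-b * (l - p) + c * k) / ((m - p) * (l - p) - n * k),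
      (-c * (m - p) + b * n) / ((m - p) * (l - p) - n * k), ?_, ?_⟩ <;>
    · rw [div_mul_eq_mul_div, div_mul_eq_mul_div, ← add_div, div_eq_iff hD]
      ring
  refine hlequiv_of_intertwine (a := 1) (b := 0) (c := 0) (d := 1) x y (by simp) ?_
  ext i j
  fin_cases i <;> fin_cases j <;> simp [Matrix.mul_apply, Fin.sum_univ_three]
  · linear_combination hx
  · linear_combination hy

/-- A nonzero lower-left column can be moved onto the `e₂`-axis. -/
lemma exists_hlequiv_column (p b c u m n w k l : ℂ) (h : u ≠ 0 ∨ w ≠ 0) :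
    ∃ p' b' c' u' m' n' k' l' : ℂ, u' ≠ 0 ∧
      HLequiv (prodOf Md12) !![p, b, c; u, m, n; w, k, l]
        !![p', b', c'; u', m', n'; 0, k', l'] := by
  by_cases hu : u = 0
  · subst hu
    have hw : w ≠ 0 := by simpa using h
    refine ⟨p, -c, -b, -w, l, k, n, m, neg_ne_zero.mpr hw, ?_⟩
    refine hlequiv_of_intertwine (a := 0) (b := 1) (c := 1) (d := 0) 0 0 (by simp) ?_
    ext i j
    fin_cases i <;> fin_cases j <;> simp [Matrix.mul_apply, Fin.sum_univ_three]
  · refine ⟨p, u * b + w * c, c, 1, m + n * w / u, n / u,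
      -w * m + u * k + (-w * n + u * l) * w / u, (-w * n + u * l) / u, one_ne_zero, ?_⟩
    refine hlequiv_of_intertwine (a := 1) (b := 0) (c := -w) (d := u) 0 0 (by simpa) ?_
    ext i j
    fin_cases i <;> fin_cases j <;> simp [Matrix.mul_apply, Fin.sum_univ_three]
    all_goals field_simp
    all_goals ring

/-- A shear replaces the second row of the lower-right block by an arbitrary row `(m', 0)`. -/
lemma exists_hlequiv_shear (p b c u m n k l m' : ℂ) (hu : u ≠ 0) :
    ∃ p' b' c' : ℂ, HLequiv (prodOf Md12) !![p, b, c; u, m, n; 0, k, l]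
      !![p', b', c'; u, m', 0; 0, k, l] := by
  obtain ⟨x, hx⟩ : ∃ x : ℂ, u * x = m - m' := ⟨(m - m') / u, mul_div_cancel₀ _ hu⟩
  obtain ⟨y, hy⟩ : ∃ y : ℂ, u * y = n := ⟨n / u, mul_div_cancel₀ _ hu⟩
  refine ⟨p + x * u, b + x * m + y * k - (p + x * u) * x, c + x * n + y * l - (p + x * u) * y, ?_⟩
  refine hlequiv_of_intertwine (a := 1) (b := 0) (c := 0) (d := 1) x y (by simp) ?_
  ext i j
  fin_cases i <;> fin_cases j <;> simp [Matrix.mul_apply, Fin.sum_univ_three]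
  · linear_combination -hx
  · exact hy.symm

lemma exists_hlequiv_of_column_ne_zero (p b c u m n w k l : ℂ) (h : u ≠ 0 ∨ w ≠ 0) :
    ∃ p' b' c' u' q w' : ℂ, (u', w') ≠ ((0 : ℂ), (0 : ℂ)) ∧
      HLequiv (prodOf Md12) !![p, b, c; u, m, n; w, k, l]
        !![p', b', c'; u', q, 0; w', 0, 0] := by
  obtain ⟨p, b, c, u, m, n, k, l, hu, h₁⟩ := exists_hlequiv_column p b c u m n w k l h
  by_cases hl : l = 0
  · subst hl
    obtain ⟨p, b, c, h₂⟩ := exists_hlequiv_shear p b c u m n k 0 1 hu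
    refine ⟨p, b + k * c, c, u, 1, -k * u, by simp [hu], (h₁.trans h₂).trans ?_⟩
    refine hlequiv_of_intertwine (a := 1) (b := 0) (c := -k) (d := 1) 0 0 (by simp) ?_
    ext i j
    fin_cases i <;> fin_cases j <;> simp [Matrix.mul_apply, Fin.sum_univ_three]
    ring
  · obtain ⟨p, b, c, h₂⟩ := exists_hlequiv_shear p b c u m n k l 0 hu
    refine ⟨p, -c, -l * b + c * k, -k * u / l, l, -u / l, by simp [hu, hl],
      (h₁.trans h₂).trans ?_⟩
    refine hlequiv_of_intertwine (a := k) (b := l) (c := 1) (d := 0) 0 0 (by simpa) ?_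
    ext i j
    fin_cases i <;> fin_cases j <;> simp [Matrix.mul_apply, Fin.sum_univ_three]
    all_goals field_simp

lemma hl_heisenberg (T : Mat3) : HL (prodOf Md12) T := by
  intro x y z
  ext i
  fin_cases i <;>
    simp [prodOf, Md12, cross3, Matrix.mulVec, dotProduct, Fin.sum_univ_three]

theorem stmt18 :
    (∀ T : Mat3, HL (prodOf Md12) T) ∧
    (∀ T : Mat3,
      (((T 1 0, T 2 0) ≠ ((0 : ℂ), (0 : ℂ)) →
        ∃ p b c u q w : ℂ, (u, w) ≠ ((0 : ℂ), (0 : ℂ)) ∧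
          HLequiv (prodOf Md12) T !![p, b, c; u, q, 0; w, 0, 0]) ∧
       ((T 1 0, T 2 0) = ((0 : ℂ), (0 : ℂ)) ∧
          (thetaLR T - T 0 0 • (1 : Matrix (Fin 2) (Fin 2) ℂ)).det ≠ 0 →
        ∃ p q s r : ℂ, (q - p) * (r - p) ≠ 0 ∧
          HLequiv (prodOf Md12) T !![p, 0, 0; 0, q, s; 0, 0, r]) ∧
       ((T 1 0, T 2 0) = ((0 : ℂ), (0 : ℂ)) ∧
          (thetaLR T - T 0 0 • (1 : Matrix (Fin 2) (Fin 2) ℂ)).det = 0 →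
        ∃ p b c q s r : ℂ, (q - p) * (r - p) = 0 ∧
          HLequiv (prodOf Md12) T !![p, b, c; 0, q, s; 0, 0, r]))) := by
  refine ⟨hl_heisenberg, fun T => ?_⟩
  have hdet : (thetaLR T - T 0 0 • (1 : Matrix (Fin 2) (Fin 2) ℂ)).det =
      (T 1 1 - T 0 0) * (T 2 2 - T 0 0) - T 1 2 * T 2 1 := by
    simp [thetaLR, Matrix.det_fin_two]
  rw [hdet]
  obtain ⟨p, b, c, u, m, n, w, k, l, rfl⟩ :
      ∃ p b c u m n w k l : ℂ, T = !![p, b, c; u, m, n; w, k, l] :=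
    ⟨_, _, _, _, _, _, _, _, _, Matrix.eta_fin_three T⟩
  clear hdet
  simp only [Matrix.of_apply, Matrix.cons_val, Prod.mk.injEq, ne_eq]
  refine ⟨fun h => ?_, ?_, ?_⟩
  · simpa using exists_hlequiv_of_column_ne_zero p b c u m n w k l (not_and_or.mp h)
  · rintro ⟨⟨rfl, rfl⟩, hD⟩
    obtain ⟨b', c', q, s, r, h0, hqr, h⟩ := exists_hlequiv_upperTriangular p 0 0 m n k l
    obtain ⟨rfl, rfl⟩ := h0 rfl rfl
    exact ⟨p, q, s, r, by rwa [hqr], (hlequiv_blockDiagonal p b c m n k l hD).trans h⟩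
  · rintro ⟨⟨rfl, rfl⟩, hD⟩
    obtain ⟨b', c', q, s, r, -, hqr, h⟩ := exists_hlequiv_upperTriangular p b c m n k l
    exact ⟨p, b', c', q, s, r, hqr.trans hD, h⟩
end
end
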